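/- Vanishing of relative Hochschild cohomology of a separable algebra: let B be a commutative ring and A a B-algebra admitting a separability idempotent, i.e., an element e ∈ A ⊗_B A with μ(e) = 1 (μ the multiplication map A ⊗_B A → A) and (a ⊗ 1)·e = e·(1 ⊗ a) for all a ∈ A. Then for every n ≥ 1, every B-multilinear map α : A^n → A with δ^n α = 0 is a coboundary: there is a B-multilinear map γ : A^{n−1} → A (for n = 1, an element γ ∈ A) with α = δ^{n−1} γ. In particular H^n(A,B;A) = 0 for all n ≥ 1. -/

import Mathlib

/-- A relative Hochschild `n`-cochain of `(A,B)` with values in `A`, for the ring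
homomorphism `f : B → A`.  For `n ≥ 1` it is a function `Aⁿ → A` additive in each
argument and satisfying the `B`-bimodule (`B`-balanced) conditions; for `n = 0` it
is an element of the centralizer `A^B` (recorded as a constant function). -/
def relCochain {B A : Type*} [Ring B] [Ring A] (f : B →+* A) (n : ℕ)
    (α : (Fin n → A) → A) : Prop :=
  (∀ (h : n = 0) (b : B),
      α (fun i => (Fin.cast h i).elim0) * f b = f b * α (fun i => (Fin.cast h i).elim0)) ∧
  (∀ (a : Fin n → A) (i : Fin n) (x y : A),
      α (Function.update a i (x + y)) =
        α (Function.update a i x) + α (Function.update a i y)) ∧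
  (∀ (a : Fin n → A) (b : B) (h0 : 0 < n),
      α (Function.update a ⟨0, h0⟩ (f b * a ⟨0, h0⟩)) = f b * α a) ∧
  (∀ (a : Fin n → A) (b : B) (h0 : 0 < n),
      α (Function.update a ⟨n - 1, Nat.sub_lt h0 Nat.one_pos⟩
          (a ⟨n - 1, Nat.sub_lt h0 Nat.one_pos⟩ * f b)) = α a * f b) ∧
  (∀ (a : Fin n → A) (b : B) (i : ℕ) (h : i + 1 < n),
      α (Function.update a ⟨i, Nat.lt_of_succ_lt h⟩
          (a ⟨i, Nat.lt_of_succ_lt h⟩ * f b)) =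
        α (Function.update a ⟨i + 1, h⟩ (f b * a ⟨i + 1, h⟩)))

/-- The relative Hochschild coboundary `δⁿ`.  For `n = 0` (a "cochain" being an
element `r = α(∅)` of `A`) it is `δ⁰(r)(a) = r·a − a·r`; for `n ≥ 1` it is
`(δⁿ α)(a₁,…,a_{n+1}) = a₁·α(a₂,…,a_{n+1}) + Σ_{i=1}^{n} (−1)^i α(a₁,…,a_i·a_{i+1},…,a_{n+1})
 + (−1)^{n+1} α(a₁,…,a_n)·a_{n+1}`. -/
def hDelta {A : Type*} [Ring A] : ∀ (n : ℕ), ((Fin n → A) → A) → (Fin (n + 1) → A) → A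
  | 0, α => fun a => α Fin.elim0 * a 0 - a 0 * α Fin.elim0
  | n + 1, α => fun a =>
      a 0 * α (fun j => a j.succ)
        + ∑ i : Fin (n + 1), (-1 : ℤ) ^ (i.1 + 1) •
            α (fun j => if j.1 < i.1 then a j.castSucc
                        else if j.1 = i.1 then a j.castSucc * a j.succ
                        else a j.succ)
        + (-1 : ℤ) ^ (n + 2) • (α (fun j => a j.castSucc) * a (Fin.last (n + 1)))

/-- The cup product of an `m`-cochain and an `n`-cochain:
`(f ∪ g)(a₁,…,a_{m+n}) = f(a₁,…,a_m)·g(a_{m+1},…,a_{m+n})`. -/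
def cup {A : Type*} [Mul A] {m n : ℕ} (α : (Fin m → A) → A) (β : (Fin n → A) → A) :
    (Fin (m + n) → A) → A :=
  fun a => α (fun i => a (Fin.castAdd n i)) * β (fun j => a (Fin.natAdd m j))

open TensorProduct in
/-- The `B`-linear map `A ⊗[B] A → Hom_B(A^m, A)` sending `x ⊗ y` to
`(a₁,…,a_m) ↦ x·α(y, a₁,…,a_m)`. -/
noncomputable def tensorContraction {B A : Type*} [CommRing B] [Ring A] [Algebra B A] {m : ℕ}
    (α : MultilinearMap B (fun _ : Fin (m + 1) => A) A) :
    A ⊗[B] A →ₗ[B] MultilinearMap B (fun _ : Fin m => A) A :=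
  TensorProduct.lift <| LinearMap.mk₂ B
    (fun x y => (LinearMap.mulLeft B x).compMultilinearMap (α.curryLeft y))
    (fun x x' y => by ext v; simp [add_mul])
    (fun c x y => by ext v; simp)
    (fun x y y' => by ext v; simp)
    (fun c x y => by ext v; simp)

open TensorProduct in
theorem tensorContraction_tmul {B A : Type*} [CommRing B] [Ring A] [Algebra B A] {m : ℕ}
    (α : MultilinearMap B (fun _ : Fin (m + 1) => A) A) (x y : A) (v : Fin m → A) :
    tensorContraction α (x ⊗ₜ[B] y) v = x * α (Fin.cons y v) := rfl

open TensorProduct in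
theorem tensorContraction_tmul_one_mul {B A : Type*} [CommRing B] [Ring A] [Algebra B A] {m : ℕ}
    (α : MultilinearMap B (fun _ : Fin (m + 1) => A) A) (c : A) (t : A ⊗[B] A) (v : Fin m → A) :
    tensorContraction α ((c ⊗ₜ[B] (1 : A)) * t) v = c * tensorContraction α t v := by
  induction t using TensorProduct.induction_on with
  | zero => simp
  | tmul x y => simp [tensorContraction_tmul, mul_assoc]
  | add s t hs ht => simp [mul_add, hs, ht]

/-- The coboundary of a cochain of positive degree, evaluated at `(y, a₁, …)`. -/
theorem hDelta_cons {A : Type*} [Ring A] {k : ℕ} (α : (Fin (k + 2) → A) → A) (y : A)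
    (a : Fin (k + 2) → A) :
    hDelta (k + 2) α (Fin.cons y a) =
      y * α a - α (Fin.cons (y * a 0) (fun j => a j.succ))
        - ∑ i : Fin (k + 1), (-1 : ℤ) ^ (i.1 + 1) •
            α (Fin.cons y (fun j => if j.1 < i.1 then a j.castSucc
                        else if j.1 = i.1 then a j.castSucc * a j.succ
                        else a j.succ))
        - (-1 : ℤ) ^ (k + 2) •
            (α (Fin.cons y (fun j => a j.castSucc)) * a (Fin.last (k + 1))) := by
  have h0 : (fun j : Fin (k + 2) =>
      if j.1 < (0 : Fin (k + 2)).1 then (Fin.cons y a : Fin (k + 3) → A) j.castSucc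
        else if j.1 = (0 : Fin (k + 2)).1 then
          (Fin.cons y a : Fin (k + 3) → A) j.castSucc * (Fin.cons y a : Fin (k + 3) → A) j.succ
        else (Fin.cons y a : Fin (k + 3) → A) j.succ) =
      Fin.cons (y * a 0) (fun j => a j.succ) := by
    funext j
    refine Fin.cases ?_ (fun j => ?_) j <;> simp
  have hs (i : Fin (k + 1)) : (fun j : Fin (k + 2) =>
      if j.1 < i.1 + 1 then (Fin.cons y a : Fin (k + 3) → A) j.castSucc
        else if j.1 = i.1 + 1 then
          (Fin.cons y a : Fin (k + 3) → A) j.castSucc * (Fin.cons y a : Fin (k + 3) → A) j.succ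
        else (Fin.cons y a : Fin (k + 3) → A) j.succ) =
      Fin.cons y (fun j => if j.1 < i.1 then a j.castSucc
                        else if j.1 = i.1 then a j.castSucc * a j.succ
                        else a j.succ) := by
    funext j
    refine Fin.cases ?_ (fun j => ?_) j
    · simp
    · simp
  have hl : (fun j : Fin (k + 2) => (Fin.cons y a : Fin (k + 3) → A) j.castSucc) =
      Fin.cons y (fun j => a j.castSucc) := by
    funext j
    refine Fin.cases ?_ (fun j => ?_) j
    · simp
    · simp
  have hlast : (Fin.cons y a : Fin (k + 3) → A) (Fin.last (k + 2)) = a (Fin.last (k + 1)) := by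
    rw [← Fin.succ_last, Fin.cons_succ]
  simp only [hDelta]
  rw [Fin.sum_univ_succ]
  simp only [h0]
  simp only [Fin.val_succ, hs, hl, hlast]
  simp only [Fin.val_zero, Fin.cons_zero, Fin.cons_succ, pow_succ _ (_ + 1), mul_neg_one, neg_smul,
    Finset.sum_neg_distrib, zero_add, pow_one, one_smul]
  generalize (Finset.sum _ _ : A) = S
  abel

open TensorProduct in
/-- Contracting a cocycle of degree at least two with a tensor `t`. -/
theorem mul'_mul_eq_of_hDelta_eq_zero {B A : Type*} [CommRing B] [Ring A] [Algebra B A] {k : ℕ}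
    (α : MultilinearMap B (fun _ : Fin (k + 2) => A) A)
    (hα : ∀ a : Fin (k + 3) → A, hDelta (k + 2) (fun v => α v) a = 0)
    (t : A ⊗[B] A) (a : Fin (k + 2) → A) :
    LinearMap.mul' B A t * α a =
      tensorContraction α (t * ((1 : A) ⊗ₜ[B] a 0)) (fun j => a j.succ)
        + ∑ i : Fin (k + 1), (-1 : ℤ) ^ (i.1 + 1) •
            tensorContraction α t (fun j => if j.1 < i.1 then a j.castSucc
                        else if j.1 = i.1 then a j.castSucc * a j.succ
                        else a j.succ)
        + (-1 : ℤ) ^ (k + 2) •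
            (tensorContraction α t (fun j => a j.castSucc) * a (Fin.last (k + 1))) := by
  induction t using TensorProduct.induction_on with
  | zero => simp
  | tmul x y =>
    have h := congrArg (x * ·) (hα (Fin.cons y a))
    simp only [hDelta_cons, mul_sub, mul_zero, Finset.mul_sum, mul_smul_comm] at h
    simp only [LinearMap.mul'_apply, Algebra.TensorProduct.tmul_mul_tmul, mul_one,
      tensorContraction_tmul, mul_assoc]
    rw [sub_sub, sub_sub, sub_eq_zero] at h
    rw [h, add_assoc]
  | add s t hs ht =>
    simp only [map_add, add_mul, hs, ht, add_apply, smul_add,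
      Finset.sum_add_distrib]
    abel

/-- The coboundary of a cochain of degree one, evaluated at `(y, a₁)`. -/
theorem hDelta_one_cons {A : Type*} [Ring A] (α : (Fin 1 → A) → A) (y : A) (a : Fin 1 → A) :
    hDelta 1 α (Fin.cons y a) =
      y * α a - α (Fin.cons (y * a 0) Fin.elim0) + α (Fin.cons y Fin.elim0) * a 0 := by
  have hc (f : Fin 1 → A) : f = Fin.cons (f 0) Fin.elim0 := by
    funext j
    rw [Subsingleton.elim j 0, Fin.cons_zero]
  have hlast : (Fin.cons y a : Fin 2 → A) (Fin.last 1) = a 0 := rfl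
  simp only [hDelta]
  rw [Fin.sum_univ_succ, Fin.sum_univ_zero, hlast,
    hc fun j : Fin 1 => (Fin.cons y a : Fin 2 → A) j.castSucc,
    hc fun j : Fin 1 => if j.1 < _ then _ else _]
  simp [sub_eq_add_neg]

open TensorProduct in
/-- Contracting a derivation with a tensor `t`. -/
theorem mul'_mul_eq_of_hDelta_one_eq_zero {B A : Type*} [CommRing B] [Ring A] [Algebra B A]
    (α : MultilinearMap B (fun _ : Fin 1 => A) A)
    (hα : ∀ a : Fin 2 → A, hDelta 1 (fun v => α v) a = 0)
    (t : A ⊗[B] A) (a : Fin 1 → A) :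
    LinearMap.mul' B A t * α a =
      tensorContraction α (t * ((1 : A) ⊗ₜ[B] a 0)) Fin.elim0
        - tensorContraction α t Fin.elim0 * a 0 := by
  induction t using TensorProduct.induction_on with
  | zero => simp
  | tmul x y =>
    have h := congrArg (x * ·) (hα (Fin.cons y a))
    simp only [hDelta_one_cons, mul_zero] at h
    simp only [LinearMap.mul'_apply, Algebra.TensorProduct.tmul_mul_tmul, mul_one,
      tensorContraction_tmul, mul_assoc]
    rw [← sub_eq_zero, ← h, mul_add, mul_sub]
    abel
  | add s t hs ht =>
    simp only [map_add, add_mul, hs, ht, add_apply]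
    abel

open TensorProduct in
/-- Vanishing of relative Hochschild cohomology of a separable
algebra: let `B` be a commutative ring and `A` a `B`-algebra admitting a
separability idempotent `e ∈ A ⊗[B] A` with `μ(e) = 1` and
`(a ⊗ 1)·e = e·(1 ⊗ a)` for all `a ∈ A`.  Then for every `n ≥ 1`, every
`B`-multilinear map `α : Aⁿ → A` with `δⁿ α = 0` is a coboundary: there is a
`B`-multilinear map `γ : A^{n−1} → A` with `α = δ^{n−1} γ`.
In particular `Hⁿ(A,B;A) = 0` for all `n ≥ 1`. -/
theorem separable_relative_cohomology_vanishes
    {B A : Type*} [CommRing B] [Ring A] [Algebra B A]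
    (e : A ⊗[B] A)
    (he1 : LinearMap.mul' B A e = 1)
    (he2 : ∀ a : A, (a ⊗ₜ[B] (1 : A)) * e = e * ((1 : A) ⊗ₜ[B] a))
    (n : ℕ) (hn : 1 ≤ n)
    (α : MultilinearMap B (fun _ : Fin n => A) A)
    (hα : ∀ a : Fin (n + 1) → A, hDelta n (fun v => α v) a = 0) :
    ∃ γ : MultilinearMap B (fun _ : Fin (n - 1) => A) A,
      ∀ a : Fin n → A,
        α a = hDelta (n - 1) (fun v => γ v)
          (fun i => a (Fin.cast (show n - 1 + 1 = n by omega) i)) := by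
  obtain _ | _ | k := n
  · omega
  · refine ⟨-tensorContraction α e, fun a => ?_⟩
    have h := mul'_mul_eq_of_hDelta_one_eq_zero α hα e a
    rw [he1, one_mul, ← he2, tensorContraction_tmul_one_mul] at h
    change α a = (-tensorContraction α e) Fin.elim0 * a 0 - a 0 * (-tensorContraction α e) Fin.elim0
    rw [h, neg_apply, neg_mul, mul_neg]
    abel
  · refine ⟨tensorContraction α e, fun a => ?_⟩
    have h := mul'_mul_eq_of_hDelta_eq_zero α hα e a
    rw [he1, one_mul, ← he2, tensorContraction_tmul_one_mul] at h
    exact h
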